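/- arXiv:2210.14337 — 10 statements merged into one kernel-verified Lean document; each statement's English description precedes it below -/
import Mathlib

section
/- Let E be a category with a strict initial object, equipped with a coherent system of subobjects. Then: (CS7) the intersection (meet in the poset of subobjects) of any two distinguished subobjects of an object A exists and is distinguished; (CS8) for any three distinguished subobjects R, S, T of A one has R ∩ (S ∪ T) = (R ∩ S) ∪ (R ∩ T); (CS9) if S is a distinguished subobject of A and T is any subobject of A with S ≤ T ≤ A, then S (viewed as a subobject of T) is distinguished in T. -/
open CategoryTheory CategoryTheory.Limits

universe w v u v' u'

namespace CoherentPaper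
section

variable {C : Type u} [Category.{v} C]

/-- `U` is the union (least upper bound) of the subobjects `S` and `T`. -/
def IsUnion {A : C} (S T U : Subobject A) : Prop :=
  S ≤ U ∧ T ≤ U ∧ ∀ V : Subobject A, S ≤ V → T ≤ V → U ≤ V

/-- `I` is the intersection (greatest lower bound) of the subobjects `S` and `T`. -/
def IsInter {A : C} (S T I : Subobject A) : Prop :=
  I ≤ S ∧ I ≤ T ∧ ∀ V : Subobject A, V ≤ S → V ≤ T → V ≤ I

/-- `P` is the pullback (inverse image) of the subobject `S` along `f`. -/
def IsPreimage {A B : C} (f : A ⟶ B) (S : Subobject B) (P : Subobject A) : Prop :=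
  ∀ ⦃X : C⦄ (g : X ⟶ A), P.Factors g ↔ S.Factors (g ≫ f)

/-- A coherent system of subobjects on a category with a (strict) initial object. -/
structure CoherentSystem (C : Type u) [Category.{v} C] [HasInitial C]
    [InitialMonoClass C] : Type (max u v) where
  Dist : ∀ {A : C}, Subobject A → Prop
  dist_bot : ∀ A : C, Dist (⊥ : Subobject A)
  dist_top : ∀ A : C, Dist (⊤ : Subobject A)
  union_exists : ∀ {A : C} {S T : Subobject A}, Dist S → Dist T →
    ∃ U : Subobject A, Dist U ∧ IsUnion S T U
  preimage_exists : ∀ {A B : C} (f : A ⟶ B) {S : Subobject B}, Dist S →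
    ∃ P : Subobject A, Dist P ∧ IsPreimage f S P
  preimage_union : ∀ {A B : C} (f : A ⟶ B) {S T U : Subobject B} {S' T' U' : Subobject A},
    Dist S → Dist T → IsUnion S T U →
    IsPreimage f S S' → IsPreimage f T T' → IsPreimage f U U' → IsUnion S' T' U'
  dist_trans : ∀ {A : C} (T : Subobject A) (S : Subobject (T : C)),
    Dist T → Dist S → Dist (Subobject.mk (S.arrow ≫ T.arrow))

variable [HasInitial C] [InitialMonoClass C]

/-- A monomorphism is distinguished when the subobject it determines is distinguished. -/
def CoherentSystem.DistMono (cs : CoherentSystem C) {S A : C} (m : S ⟶ A) : Prop :=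
  ∃ h : Mono m, cs.Dist (@Subobject.mk _ _ _ _ m h)

/-- An epimorphism is distinguished when it does not factor through any proper
distinguished subobject of its codomain. -/
def CoherentSystem.DistEpi (cs : CoherentSystem C) {A B : C} (e : A ⟶ B) : Prop :=
  Epi e ∧ ∀ S : Subobject B, cs.Dist S → S.Factors e → S = ⊤

end
theorem mk_comp_le_iff {C : Type u} [Category.{v} C] {A : C} (R V : Subobject A)
    (P : Subobject (R : C)) :
    Subobject.mk (P.arrow ≫ R.arrow) ≤ V ↔ V.Factors (P.arrow ≫ R.arrow) := by
  constructor
  · intro h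
    exact Subobject.factors_of_le _ h ((Subobject.mk_factors_iff _ _).2 ⟨𝟙 _, by simp⟩)
  · intro h
    exact Subobject.mk_le_of_comm (V.factorThru _ h) (by simp)

theorem factors_of_arrow {C : Type u} [Category.{v} C] {A : C} (P : Subobject A) :
    P.Factors P.arrow := by
  simpa using Subobject.factors_comp_arrow (P := P) (𝟙 _)

theorem le_of_factors_arrow {C : Type u} [Category.{v} C] {A : C} {P Q : Subobject A}
    (h : Q.Factors P.arrow) : P ≤ Q :=
  Subobject.le_of_comm (Q.factorThru _ h) (by simp)

theorem mk_ofLE_factors {C : Type u} [Category.{v} C] {A : C} {S T : Subobject A} (h : S ≤ T)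
    {X : C} (g : X ⟶ (T : C)) :
    (Subobject.mk (Subobject.ofLE S T h)).Factors g ↔ S.Factors (g ≫ T.arrow) := by
  rw [Subobject.mk_factors_iff]
  constructor
  · rintro ⟨k, hk⟩
    obtain ⟨k', hk'⟩ : ∃ k' : X ⟶ (S : C), k' ≫ Subobject.ofLE S T h = g := ⟨k, hk⟩
    rw [← hk', Category.assoc, Subobject.ofLE_arrow]
    exact Subobject.factors_comp_arrow _
  · intro hf
    refine ⟨S.factorThru _ hf, ?_⟩
    show S.factorThru _ hf ≫ Subobject.ofLE S T h = g
    rw [← cancel_mono T.arrow]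
    simp

theorem isInter_of_isPreimage {C : Type u} [Category.{v} C] {A : C} {R S : Subobject A}
    {P : Subobject (R : C)} (hP : IsPreimage R.arrow S P) :
    IsInter R S (Subobject.mk (P.arrow ≫ R.arrow)) := by
  refine ⟨?_, ?_, ?_⟩
  · rw [mk_comp_le_iff]
    exact Subobject.factors_comp_arrow _
  · rw [mk_comp_le_iff]
    exact (hP _).1 (factors_of_arrow P)
  · intro V h1 h2
    have h3 : P.Factors (Subobject.ofLE V R h1) := by
      rw [hP, Subobject.ofLE_arrow]
      exact Subobject.factors_of_le _ h2 (factors_of_arrow V)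
    exact Subobject.le_mk_of_comm (P.factorThru _ h3) (by simp)

theorem IsInter.unique {C : Type u} [Category.{v} C] {A : C} {R S I J : Subobject A}
    (h : IsInter R S I) (h' : IsInter R S J) : I = J :=
  le_antisymm (h'.2.2 _ h.1 h.2.1) (h.2.2 _ h'.1 h'.2.1)

theorem IsUnion.unique {C : Type u} [Category.{v} C] {A : C} {R S I J : Subobject A}
    (h : IsUnion R S I) (h' : IsUnion R S J) : I = J :=
  le_antisymm (h.2.2 _ h'.1 h'.2.1) (h'.2.2 _ h.1 h.2.1)

/-- Proposition 2.2 (CS7, CS8, CS9). -/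
theorem statement0 {C : Type u} [Category.{v} C] [HasInitial C] [HasStrictInitialObjects C]
    (cs : CoherentSystem C) :
    -- (CS7) the intersection of two distinguished subobjects exists and is distinguished
    (∀ {A : C} (S T : Subobject A), cs.Dist S → cs.Dist T →
      ∃ I : Subobject A, cs.Dist I ∧ IsInter S T I) ∧
    -- (CS8) distributivity of intersections over unions of distinguished subobjects
    (∀ {A : C} (R S T : Subobject A), cs.Dist R → cs.Dist S → cs.Dist T →
      ∀ U I RS RT V : Subobject A, IsUnion S T U → IsInter R U I →
        IsInter R S RS → IsInter R T RT → IsUnion RS RT V → I = V) ∧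
    -- (CS9) a distinguished subobject of `A` is distinguished in every intermediate subobject
    (∀ {A : C} (S T : Subobject A), cs.Dist S → ∀ h : S ≤ T,
      cs.Dist (Subobject.mk (Subobject.ofLE S T h))) := by
  refine ⟨?_, ?_, ?_⟩
  · intro A S T hS hT
    obtain ⟨P, hPd, hP⟩ := cs.preimage_exists S.arrow hT
    exact ⟨_, cs.dist_trans S P hS hPd, isInter_of_isPreimage hP⟩
  · intro A R S T hR hS hT U I RS RT V hU hI hRS hRT hV
    obtain ⟨U', hU'd, hU'⟩ := cs.union_exists hS hT
    obtain rfl := hU.unique hU'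
    obtain ⟨PS, -, hPS⟩ := cs.preimage_exists R.arrow hS
    obtain ⟨PT, -, hPT⟩ := cs.preimage_exists R.arrow hT
    obtain ⟨PU, -, hPU⟩ := cs.preimage_exists R.arrow hU'd
    have hun := cs.preimage_union R.arrow hS hT hU hPS hPT hPU
    obtain rfl := hRS.unique (isInter_of_isPreimage hPS)
    obtain rfl := hRT.unique (isInter_of_isPreimage hPT)
    obtain rfl := hI.unique (isInter_of_isPreimage hPU)
    apply le_antisymm
    · have hVR : V ≤ R := hV.2.2 _ hRS.1 hRT.1
      rw [mk_comp_le_iff, ← mk_ofLE_factors hVR]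
      refine Subobject.factors_of_le _ (hun.2.2 _ ?_ ?_) (factors_of_arrow PU)
      · apply le_of_factors_arrow
        rw [mk_ofLE_factors, ← mk_comp_le_iff]
        exact hV.1
      · apply le_of_factors_arrow
        rw [mk_ofLE_factors, ← mk_comp_le_iff]
        exact hV.2.1
    · exact hV.2.2 _ (hI.2.2 _ hRS.1 (hRS.2.1.trans hU.1))
        (hI.2.2 _ hRT.1 (hRT.2.1.trans hU.2.1))
  · intro A S T hS h
    obtain ⟨P, hPd, hP⟩ := cs.preimage_exists T.arrow hS
    have : Subobject.mk (Subobject.ofLE S T h) = P := by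
      apply le_antisymm
      · apply le_of_factors_arrow
        rw [hP, ← mk_ofLE_factors h]
        exact factors_of_arrow _
      · apply le_of_factors_arrow
        rw [mk_ofLE_factors, ← hP]
        exact factors_of_arrow _
    rw [this]
    exact hPd

end CoherentPaper
end

section
/- Let E be a category with a strict initial object, equipped with a coherent system of subobjects. An epimorphism e: A → B is distinguished if and only if it is left orthogonal to every distinguished monomorphism; that is, if and only if for every distinguished monomorphism m: S ↪ C and every commutative square m ∘ u = v ∘ e (with u: A → S, v: B → C), there exists a unique morphism t: B → S with t ∘ e = u and m ∘ t = v. -/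
open CategoryTheory CategoryTheory.Limits

universe w v u v' u'

namespace CoherentPaper
/-- Proposition 2.4: an epimorphism is distinguished iff it is left orthogonal to every
distinguished monomorphism. -/
theorem statement1 {C : Type u} [Category.{v} C] [HasInitial C] [HasStrictInitialObjects C]
    (cs : CoherentSystem C) {A B : C} (e : A ⟶ B) (he : Epi e) :
    cs.DistEpi e ↔
      ∀ {S D : C} (m : S ⟶ D), cs.DistMono m →
        ∀ (u : A ⟶ S) (v : B ⟶ D), u ≫ m = e ≫ v →
          ∃! t : B ⟶ S, e ≫ t = u ∧ t ≫ m = v := by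
  constructor
  · rintro ⟨_, h⟩ S D m ⟨hm, hd⟩ u v huv
    obtain ⟨P, hP, hpre⟩ := cs.preimage_exists v hd
    have hPe : P.Factors e := (hpre e).2 ((Subobject.mk_factors_iff _ _).2 ⟨u, huv⟩)
    have hT := h P hP hPe
    subst hT
    have hv := (hpre (𝟙 B)).1 (Subobject.top_factors _)
    rw [Category.id_comp] at hv
    have hex : ∃ t : B ⟶ S, t ≫ m = v := (Subobject.mk_factors_iff _ _).1 hv
    obtain ⟨t, ht⟩ := hex
    refine ⟨t, ⟨?_, ht⟩, ?_⟩
    · rw [← cancel_mono m, Category.assoc, ht, huv]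
    · rintro t' ⟨_, h2⟩
      rw [← cancel_mono m, h2, ht]
  · intro h
    refine ⟨he, fun S hS hf => ?_⟩
    obtain ⟨t, ⟨_, ht⟩, _⟩ := h S.arrow ⟨inferInstance, by rwa [Subobject.mk_arrow]⟩
      (S.factorThru e hf) (𝟙 B) (by simp)
    rw [eq_top_iff, Subobject.top_eq_id]
    exact Subobject.mk_le_of_comm t ht

end CoherentPaper
end

section
/- Let E be a category with a strict initial object, equipped with a coherent system of subobjects. Then: (1) the composite of two distinguished epimorphisms is a distinguished epimorphism; (2) if a composite g ∘ f is a distinguished epimorphism, then g is a distinguished epimorphism. -/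
open CategoryTheory CategoryTheory.Limits

universe w v u v' u'

namespace CoherentPaper
/-- Proposition 2.5: distinguished epimorphisms compose, and the second factor of a
distinguished epimorphism is a distinguished epimorphism. -/
theorem statement2 {C : Type u} [Category.{v} C] [HasInitial C] [HasStrictInitialObjects C]
    (cs : CoherentSystem C) :
    (∀ {A B D : C} (f : A ⟶ B) (g : B ⟶ D),
      cs.DistEpi f → cs.DistEpi g → cs.DistEpi (f ≫ g)) ∧
    (∀ {A B D : C} (f : A ⟶ B) (g : B ⟶ D),
      cs.DistEpi (f ≫ g) → cs.DistEpi g) := by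
  refine ⟨?_, ?_⟩
  · rintro A B D f g ⟨hf, hf'⟩ ⟨hg, hg'⟩
    refine ⟨epi_comp f g, fun S hS hfac => hg' S hS ?_⟩
    obtain ⟨P, hP, hpre⟩ := cs.preimage_exists g hS
    have hT : P = ⊤ := hf' P hP ((hpre f).2 hfac)
    have h := (hpre (𝟙 B)).1 (by rw [hT]; exact Subobject.top_factors _)
    simpa using h
  · rintro A B D f g ⟨hfg, h⟩
    exact ⟨epi_of_epi f g, fun S hS hfac =>
      h S hS (Subobject.factors_of_factors_right f hfac)⟩

end CoherentPaper
end

section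
/- Let E be a category with a strict initial object, equipped with a pretorsion theory and a coherent system of subobjects which are compatible. If s: S ↪ A is a distinguished monomorphism and f: X → S is a morphism such that s ∘ f is trivial, then f is trivial. -/
open CategoryTheory CategoryTheory.Limits

universe w v u v' u'

namespace CoherentPaper
section

variable {C : Type u} [Category.{v} C]

/-- The data of a pretorsion theory: torsion and torsion-free classes together with the
canonical short Z-exact sequence of every object. -/
structure PretorsionData (C : Type u) [Category.{v} C] : Type (max u v) where
  torsion : Set C
  torsionFree : Set C
  torsion_iso_closed : ∀ {X Y : C}, (X ≅ Y) → X ∈ torsion → Y ∈ torsion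
  torsionFree_iso_closed : ∀ {X Y : C}, (X ≅ Y) → X ∈ torsionFree → Y ∈ torsionFree
  t : C → C
  f : C → C
  ε : ∀ A : C, t A ⟶ A
  η : ∀ A : C, A ⟶ f A

/-- Trivial objects: both torsion and torsion-free. -/
def PretorsionData.TrivialObj (P : PretorsionData C) (A : C) : Prop :=
  A ∈ P.torsion ∧ A ∈ P.torsionFree

/-- Trivial morphisms: those factoring through a trivial object. -/
def PretorsionData.Trivial (P : PretorsionData C) {A B : C} (g : A ⟶ B) : Prop :=
  ∃ (D : C) (u : A ⟶ D) (v : D ⟶ B), P.TrivialObj D ∧ g = u ≫ v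

/-- `k` is a Z-kernel of `q`. -/
def PretorsionData.IsZKernel (P : PretorsionData C) {K A Q : C} (k : K ⟶ A) (q : A ⟶ Q) :
    Prop :=
  P.Trivial (k ≫ q) ∧
    ∀ ⦃X : C⦄ (m : X ⟶ A), P.Trivial (m ≫ q) → ∃! u : X ⟶ K, u ≫ k = m

/-- `q` is a Z-cokernel of `k`. -/
def PretorsionData.IsZCokernel (P : PretorsionData C) {K A Q : C} (k : K ⟶ A) (q : A ⟶ Q) :
    Prop :=
  P.Trivial (k ≫ q) ∧
    ∀ ⦃X : C⦄ (m : A ⟶ X), P.Trivial (k ≫ m) → ∃! u : Q ⟶ X, q ≫ u = m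

/-- `K —k→ A —q→ Q` is a short Z-exact sequence. -/
def PretorsionData.ShortZExact (P : PretorsionData C) {K A Q : C} (k : K ⟶ A) (q : A ⟶ Q) :
    Prop :=
  P.IsZKernel k q ∧ P.IsZCokernel k q

/-- A pretorsion theory. -/
structure Pretorsion (C : Type u) [Category.{v} C] extends PretorsionData C where
  pt1 : ∀ {A B : C}, A ∈ torsion → B ∈ torsionFree → ∀ g : A ⟶ B,
    toPretorsionData.Trivial g
  t_mem : ∀ A : C, t A ∈ torsion
  f_mem : ∀ A : C, f A ∈ torsionFree
  zexact : ∀ A : C, toPretorsionData.ShortZExact (ε A) (η A)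

/-- A torsion theory is a pretorsion theory all of whose trivial objects are zero objects. -/
def IsTorsionTheory {D : Type u'} [Category.{v'} D] (Q : Pretorsion D) : Prop :=
  ∀ X : D, Q.TrivialObj X → IsZero X

/-- A torsion functor: it preserves torsion objects, torsion-free objects, and the
canonical short Z-exact sequences of axiom (PT2). -/
def IsTorsionFunctor {D : Type u} [Category.{v} D] {E : Type u'} [Category.{v'} E]
    (F : D ⥤ E) (P : Pretorsion D) (Q : Pretorsion E) : Prop :=
  (∀ A : D, A ∈ P.torsion → F.obj A ∈ Q.torsion) ∧
  (∀ A : D, A ∈ P.torsionFree → F.obj A ∈ Q.torsionFree) ∧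
  (∀ A : D, Q.ShortZExact (F.map (P.ε A)) (F.map (P.η A)))

variable [HasInitial C] [InitialMonoClass C]

/-- Compatibility between a pretorsion theory and a coherent system of subobjects. -/
structure Compatible (cs : CoherentSystem C) (P : Pretorsion C) : Prop where
  cc1 : ∀ {A : C} (S : Subobject A), P.TrivialObj A → cs.Dist S → P.TrivialObj (S : C)
  cc2 : ∀ {A B : C} {S T U : Subobject A}, cs.Dist S → cs.Dist T → IsUnion S T U →
    ∀ (hS : S ≤ U) (hT : T ≤ U) (g : (U : C) ⟶ B),
      P.Trivial (Subobject.ofLE S U hS ≫ g) → P.Trivial (Subobject.ofLE T U hT ≫ g) →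
      P.Trivial g
  cc3 : ∀ {S A : C} (s : S ⟶ A), cs.DistMono s → ∀ ψ : P.f S ⟶ P.f A,
    P.η S ≫ ψ = s ≫ P.η A → cs.DistMono ψ
  cc4 : ∀ {A S Pb : C} (s : S ⟶ P.f A), cs.DistMono s → ∀ (u : Pb ⟶ A) (v : Pb ⟶ S),
    IsPullback v u s (P.η A) → cs.DistEpi v
  cc5 : ∀ {S A : C} (s : S ⟶ A), cs.DistMono s → ∀ ψ : P.f S ⟶ P.f A,
    P.η S ≫ ψ = s ≫ P.η A → IsIso ψ → IsIso s

end
/-- Proposition 4.3: if `s ∘ f` is trivial and `s` is a distinguished monomorphism,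
then `f` is trivial. -/
theorem statement5 {C : Type u} [Category.{v} C] [HasInitial C] [HasStrictInitialObjects C]
    (cs : CoherentSystem C) (P : Pretorsion C) (hc : Compatible cs P)
    {X S A : C} (s : S ⟶ A) (hs : cs.DistMono s) (f : X ⟶ S)
    (h : P.Trivial (f ≫ s)) : P.Trivial f := by
  obtain ⟨D, u, v, hD, e⟩ := h
  obtain ⟨hm, hd⟩ := hs
  obtain ⟨Q, hQ, hpre⟩ := cs.preimage_exists v hd
  have h1 : Q.Factors u := (hpre u).2 (by
    rw [← e]; exact (Subobject.mk_factors_iff s _).2 ⟨f, rfl⟩)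
  have h2 : (Subobject.mk s).Factors (Q.arrow ≫ v) :=
    (hpre Q.arrow).1 ((Subobject.factors_iff _ _).2 ⟨𝟙 _, by simp⟩)
  obtain ⟨b, hb'⟩ : ∃ b : (Q : C) ⟶ S, b ≫ s = Q.arrow ≫ v := (Subobject.mk_factors_iff s _).1 h2
  refine ⟨(Q : C), Q.factorThru u h1, b, hc.cc1 Q hD hQ, ?_⟩
  rw [← cancel_mono s, Category.assoc, hb', ← Category.assoc, Subobject.factorThru_arrow, e]

end CoherentPaper
end

section
/- Let E be a category with a strict initial object, equipped with a pretorsion theory and a coherent system of subobjects which are compatible. Then the class of torsion-free objects is closed under distinguished subobjects: if A is torsion-free and S ↪ A is a distinguished monomorphism, then S is torsion-free. -/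
open CategoryTheory CategoryTheory.Limits

universe w v u v' u'

namespace CoherentPaper
/-- Proposition 4.4: the class of torsion-free objects is closed under distinguished
subobjects. -/
theorem statement6 {C : Type u} [Category.{v} C] [HasInitial C] [HasStrictInitialObjects C]
    (cs : CoherentSystem C) (P : Pretorsion C) (hc : Compatible cs P)
    {S A : C} (hA : A ∈ P.torsionFree) (s : S ⟶ A) (hs : cs.DistMono s) :
    S ∈ P.torsionFree := by
  have triv_post : ∀ {X Y Z : C} (a : X ⟶ Y) (b : Y ⟶ Z), P.Trivial a → P.Trivial (a ≫ b) := by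
    rintro X Y Z a b ⟨D, u, v, hD, rfl⟩
    exact ⟨D, u, v ≫ b, hD, by simp⟩
  have epi_η : ∀ {X Y : C} (a b : P.f X ⟶ Y), P.η X ≫ a = P.η X ≫ b → a = b := by
    intro X Y a b h
    have h1 : P.Trivial (P.ε X ≫ P.η X ≫ b) := by
      rw [← Category.assoc]
      exact triv_post _ _ (P.zexact X).2.1
    exact ((P.zexact X).2.2 _ h1).unique h rfl
  obtain ⟨r, hr, -⟩ := (P.zexact A).2.2 (𝟙 A) (P.pt1 (P.t_mem A) hA _)
  have hr2 : r ≫ P.η A = 𝟙 _ := by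
    apply epi_η
    rw [← Category.assoc, hr]; simp
  obtain ⟨ψ, hψ, -⟩ := (P.zexact S).2.2 (s ≫ P.η A) (P.pt1 (P.t_mem S) (P.f_mem A) _)
  obtain ⟨hψm, -⟩ := hc.cc3 s hs ψ hψ
  obtain ⟨hsm, hsd⟩ := hs
  have key : P.η S ≫ ψ ≫ r = s := by
    rw [← Category.assoc, hψ, Category.assoc, hr, Category.comp_id]
  have hcan : ∀ {X : C} (a b : X ⟶ P.f S), a ≫ ψ ≫ r = b ≫ ψ ≫ r → a = b := by
    intro X a b h
    have h2 := congrArg (fun z => z ≫ P.η A) h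
    simp only [Category.assoc, hr2, Category.comp_id] at h2
    exact (cancel_mono ψ).1 h2
  have hη : Mono (P.η S) := by
    have : Mono (P.η S ≫ ψ ≫ r) := by rw [key]; exact hsm
    exact mono_of_mono (P.η S) (ψ ≫ r)
  obtain ⟨Q, hQ, hQp⟩ := cs.preimage_exists (ψ ≫ r) hsd
  have hfac : Q.Factors (P.η S) := by
    rw [hQp, key]
    exact Subobject.mk_factors_self s
  have htop : cs.DistMono (𝟙 (P.f S)) := ⟨inferInstance, by
    rw [← Subobject.top_eq_id]; exact cs.dist_top _⟩
  have hepi := hc.cc4 (𝟙 (P.f S)) htop (𝟙 S) (P.η S) (IsPullback.of_vert_isIso ⟨by simp⟩)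
  have hQt := hepi.2 Q hQ hfac
  have h3 : (Subobject.mk s).Factors (𝟙 _ ≫ ψ ≫ r) := by
    rw [← hQp, hQt]; exact Subobject.top_factors _
  obtain ⟨g, hg'⟩ : ∃ g : P.f S ⟶ S, g ≫ s = 𝟙 _ ≫ ψ ≫ r := (Subobject.mk_factors_iff _ _).1 h3
  have hsec : g ≫ P.η S = 𝟙 _ := hcan _ _ (by rw [Category.assoc, key, hg'])
  have hret : P.η S ≫ g = 𝟙 _ := by
    rw [← cancel_mono (P.η S), Category.assoc, hsec]; simp
  exact P.torsionFree_iso_closed ⟨g, P.η S, hsec, hret⟩ (P.f_mem S)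

end CoherentPaper
end

section
/- Let E be a category with a strict initial object, equipped with a pretorsion theory and a coherent system of subobjects which are compatible. Let s: S ↪ A be a distinguished monomorphism, and let τ(s): τ(S) → τ(A) and φ(s): φ(S) → φ(A) be the (unique) morphisms satisfying ε_A ∘ τ(s) = s ∘ ε_S and φ(s) ∘ η_S = η_A ∘ s, where τ(S) →ε_S S →η_S φ(S) and τ(A) →ε_A A →η_A φ(A) are the canonical short Z-exact sequences. Then τ(s) and φ(s) are distinguished monomorphisms, and both commutative squares (the one with ε's and the one with η's) are pullback squares. -/
open CategoryTheory CategoryTheory.Limits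

universe w v u v' u'

namespace CoherentPaper
section
variable {C : Type u} [Category.{v} C]

lemma preimage_isPullback {A B M : C} (f : A ⟶ B) (m : M ⟶ B) [Mono m] (Q : Subobject A)
    (h : IsPreimage f (Subobject.mk m) Q) :
    ∃ v : (Q : C) ⟶ M, IsPullback Q.arrow v f m := by
  have h1 : (Subobject.mk m).Factors (Q.arrow ≫ f) :=
    (h Q.arrow).1 (Subobject.factors_self Q)
  have h2 : ∃ v : (Q : C) ⟶ M, v ≫ m = Q.arrow ≫ f := (Subobject.mk_factors_iff _ _).1 h1
  obtain ⟨v, hv⟩ := h2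
  refine ⟨v, ⟨⟨hv.symm⟩, ⟨PullbackCone.IsLimit.mk _ (fun c => Q.factorThru c.fst ?_) ?_ ?_ ?_⟩⟩⟩
  · exact (h c.fst).2 ((Subobject.mk_factors_iff _ _).2 ⟨c.snd, c.condition.symm⟩)
  · intro c
    simp
  · intro c
    rw [← cancel_mono m, Category.assoc, hv, ← Category.assoc, Subobject.factorThru_arrow]
    exact c.condition
  · intro c k hk _
    rw [← cancel_mono Q.arrow, hk, Subobject.factorThru_arrow]

variable [HasInitial C] [InitialMonoClass C]

lemma distMono_of_isPullback (cs : CoherentSystem C) {A B M K : C} {f : A ⟶ B} {m : M ⟶ B}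
    {k : K ⟶ A} {v : K ⟶ M} (hp : IsPullback k v f m) (hm : cs.DistMono m) : cs.DistMono k := by
  obtain ⟨hmono, hd⟩ := hm
  have hk : Mono k := ⟨fun a b hab => hp.hom_ext hab (by
    rw [← cancel_mono m, Category.assoc, Category.assoc, ← hp.w, reassoc_of% hab])⟩
  obtain ⟨Q, hQ, hpre⟩ := cs.preimage_exists f hd
  refine ⟨hk, ?_⟩
  have : Subobject.mk k = Q := by
    apply le_antisymm
    · have : Q.Factors k := (hpre k).2 ((Subobject.mk_factors_iff _ _).2 ⟨v, hp.w.symm⟩)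
      exact Subobject.mk_le_of_comm (Q.factorThru k this) (Subobject.factorThru_arrow _ _ _)
    · obtain ⟨w, hw⟩ := preimage_isPullback f m Q hpre
      exact Subobject.le_mk_of_comm (hp.lift Q.arrow w hw.w) (hp.lift_fst _ _ _)
  rw [this]; exact hQ

lemma ε_mono (P : Pretorsion C) (A : C) : Mono (P.ε A) := ⟨fun a b hab => by
  have ht : P.Trivial ((a ≫ P.ε A) ≫ P.η A) := by
    obtain ⟨D, x, y, hD, h⟩ := (P.zexact A).1.1
    exact ⟨D, a ≫ x, y, hD, by rw [Category.assoc, h, Category.assoc]⟩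
  exact ((P.zexact A).1.2 _ ht).unique rfl hab.symm⟩

lemma η_epi (P : Pretorsion C) (A : C) : Epi (P.η A) := ⟨fun a b hab => by
  have ht : P.Trivial (P.ε A ≫ (P.η A ≫ a)) := by
    obtain ⟨D, x, y, hD, h⟩ := (P.zexact A).1.1
    exact ⟨D, x, y ≫ a, hD, by rw [← Category.assoc, h, Category.assoc]⟩
  exact ((P.zexact A).2.2 _ ht).unique rfl hab.symm⟩

lemma exists_desc (P : Pretorsion C) {A B : C} (hB : B ∈ P.torsionFree) (g : A ⟶ B) :
    ∃ w : P.f A ⟶ B, P.η A ≫ w = g :=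
  ((P.zexact A).2.2 g (P.pt1 (P.t_mem A) hB _)).exists

end

/-- Proposition 4.7: for a distinguished monomorphism `s : S ↪ A`, the induced morphisms
`τ(s)` and `φ(s)` are distinguished monomorphisms and both canonical squares are
pullbacks. -/
theorem statement8 {C : Type u} [Category.{v} C] [HasInitial C] [HasStrictInitialObjects C]
    (cs : CoherentSystem C) (P : Pretorsion C) (hc : Compatible cs P)
    {S A : C} (s : S ⟶ A) (hs : cs.DistMono s)
    (ts : P.t S ⟶ P.t A) (hts : P.ε S ≫ s = ts ≫ P.ε A)
    (fs : P.f S ⟶ P.f A) (hfs : P.η S ≫ fs = s ≫ P.η A) :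
    cs.DistMono ts ∧ cs.DistMono fs ∧
      IsPullback (P.ε S) ts s (P.ε A) ∧ IsPullback s (P.η S) (P.η A) fs := by
  have hfd := hc.cc3 s hs fs hfs
  have hsm : Mono s := hs.1
  have hfm : Mono fs := hfd.1
  have := ε_mono P A
  have := ε_mono P S
  have h1 : IsPullback (P.ε S) ts s (P.ε A) := by
    have key : ∀ c : PullbackCone s (P.ε A), ∃ u, u ≫ P.ε S = c.fst := by
      intro c
      refine ((P.zexact S).1.2 c.fst ?_).exists
      obtain ⟨D, x, y, hD, h⟩ := (P.zexact A).1.1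
      obtain ⟨Q, hQ, hpre⟩ := cs.preimage_exists y hfd.2
      obtain ⟨v, hv⟩ := preimage_isPullback y fs Q hpre
      have hw : (c.snd ≫ x) ≫ y = (c.fst ≫ P.η S) ≫ fs := by
        rw [Category.assoc, Category.assoc, ← h, hfs, ← Category.assoc, ← Category.assoc,
          c.condition]
      exact ⟨Q, hv.lift _ _ hw, v, hc.cc1 Q hD hQ, (hv.lift_snd _ _ hw).symm⟩
    choose l hl using key
    refine ⟨⟨hts⟩, ⟨PullbackCone.IsLimit.mk _ l hl ?_ ?_⟩⟩
    · intro c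
      rw [← cancel_mono (P.ε A), Category.assoc, ← hts, ← Category.assoc, hl, c.condition]
    · intro c k hk _
      rw [← cancel_mono (P.ε S), hk, hl]
  refine ⟨distMono_of_isPullback cs h1.flip hs, hfd, h1, ?_⟩
  obtain ⟨Q, hQ, hpre⟩ := cs.preimage_exists (P.η A) hfd.2
  obtain ⟨v, hv⟩ := preimage_isPullback (P.η A) fs Q hpre
  have hud : cs.DistMono Q.arrow := distMono_of_isPullback cs hv hfd
  let j := hv.lift s (P.η S) hfs.symm
  have hj1 : j ≫ Q.arrow = s := hv.lift_fst _ _ _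
  have hj2 : j ≫ v = P.η S := hv.lift_snd _ _ _
  have hjp : IsPullback j (𝟙 S) Q.arrow s := by
    refine ⟨⟨by simp [hj1]⟩, ⟨PullbackCone.IsLimit.mk _ (fun c => c.snd) ?_ ?_ ?_⟩⟩
    · intro c
      rw [← cancel_mono Q.arrow, Category.assoc, hj1, c.condition]
    · intro c
      simp
    · intro c k _ hk
      simpa using hk
  have hjd : cs.DistMono j := distMono_of_isPullback cs hjp hs
  obtain ⟨w, hw⟩ := exists_desc P (P.f_mem S) v
  obtain ⟨fu, hfu⟩ := exists_desc P (P.f_mem A) (Q.arrow ≫ P.η A)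
  obtain ⟨fj, hfj⟩ := exists_desc P (P.f_mem Q) (j ≫ P.η Q)
  have : Mono fu := (hc.cc3 _ hud fu hfu).1
  have := η_epi P S
  have := η_epi P (Q : C)
  have e1 : w ≫ fs = fu := by
    rw [← cancel_epi (P.η (Q : C)), ← Category.assoc, hw, hfu, hv.w]
  have e2 : fj ≫ w = 𝟙 _ := by
    rw [← cancel_epi (P.η S), ← Category.assoc, hfj, Category.assoc, hw, hj2, Category.comp_id]
  have e3 : w ≫ fj = 𝟙 _ := by
    rw [← cancel_mono fu, Category.assoc, Category.id_comp]
    conv_lhs => rw [← e1, ← Category.assoc fj, e2, Category.id_comp]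
    exact e1
  have : IsIso j := hc.cc5 j hjd fj hfj ⟨w, e2, e3⟩
  refine IsPullback.of_iso hv (asIso j).symm (Iso.refl _) (Iso.refl _) (Iso.refl _) ?_ ?_ ?_ ?_
  all_goals simp [← hj1, ← hj2]

end CoherentPaper
end

section
/- Let E be a category with a strict initial object, equipped with a pretorsion theory and a coherent system of subobjects which are compatible. Then the class of torsion objects is closed under distinguished subobjects: if A is a torsion object and S ↪ A is a distinguished monomorphism, then S is a torsion object. -/
open CategoryTheory CategoryTheory.Limits

universe w v u v' u'

namespace CoherentPaper
theorem torsion_of_trivial_eta {C : Type u} [Category.{v} C] (P : Pretorsion C) {X : C}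
    (h : P.Trivial (P.η X)) : X ∈ P.torsion := by
  obtain ⟨⟨h1, h2⟩, -⟩ := P.zexact X
  obtain ⟨w, hw, -⟩ := h2 (𝟙 X) (by simpa using h)
  have h3 : P.Trivial (P.ε X ≫ P.η X) := h1
  have e : P.ε X ≫ w = 𝟙 _ :=
    (h2 (P.ε X) h3).unique (by simp only [Category.assoc, hw, Category.comp_id]) (by simp)
  exact P.torsion_iso_closed ⟨P.ε X, w, e, hw⟩ (P.t_mem X)

theorem f_trivial {C : Type u} [Category.{v} C] (P : Pretorsion C) {A : C}
    (hA : A ∈ P.torsion) : P.TrivialObj (P.f A) := by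
  refine ⟨?_, P.f_mem A⟩
  obtain ⟨D, a, b, hD, e⟩ := P.pt1 hA (P.f_mem A) (P.η A)
  obtain ⟨-, h1, h2⟩ := P.zexact A
  obtain ⟨w, hw, -⟩ := h2 a ⟨D, P.ε A ≫ a, 𝟙 D, hD, by simp⟩
  have hwb : w ≫ b = 𝟙 _ :=
    (h2 (P.η A) h1).unique (by rw [← Category.assoc, hw, ← e]) (by simp)
  apply torsion_of_trivial_eta
  obtain ⟨D', a', b', hD', e'⟩ := P.pt1 hD.1 (P.f_mem _) (b ≫ P.η (P.f A))
  exact ⟨D', w ≫ a', b', hD', by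
    rw [Category.assoc, ← e', ← Category.assoc, hwb, Category.id_comp]⟩

/-- Corollary 4.9: the class of torsion objects is closed under distinguished
subobjects. -/
theorem statement9 {C : Type u} [Category.{v} C] [HasInitial C] [HasStrictInitialObjects C]
    (cs : CoherentSystem C) (P : Pretorsion C) (hc : Compatible cs P)
    {S A : C} (hA : A ∈ P.torsion) (s : S ⟶ A) (hs : cs.DistMono s) :
    S ∈ P.torsion := by
  have hfA := f_trivial P hA
  obtain ⟨-, h1, h2⟩ := P.zexact S
  obtain ⟨ψ, hψ, -⟩ := h2 (s ≫ P.η A)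
    ⟨P.f A, P.ε S ≫ s ≫ P.η A, 𝟙 _, hfA, by simp⟩
  obtain ⟨hm, hd⟩ := hc.cc3 s hs ψ hψ
  have ht := hc.cc1 _ hfA hd
  have i := Subobject.underlyingIso ψ
  have hS : P.TrivialObj (P.f S) :=
    ⟨P.torsion_iso_closed i ht.1, P.f_mem S⟩
  exact torsion_of_trivial_eta P ⟨P.f S, P.η S, 𝟙 _, hS, by simp⟩

end CoherentPaper
end

section
/- Let E be a category with a strict initial object, equipped with a pretorsion theory and a coherent system of subobjects which are compatible. Let R and S be two distinguished subobjects of an object A, and regard φ(R) and φ(S) as distinguished subobjects of φ(A) via the distinguished monomorphisms φ of the inclusions. Then φ preserves union and intersection: φ(S ∪ R) = φ(S) ∪ φ(R) and φ(S ∩ R) = φ(S) ∩ φ(R) as subobjects of φ(A). -/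
open CategoryTheory CategoryTheory.Limits

universe w v u v' u'

namespace CoherentPaper
theorem le_of_factors {C : Type u} [Category.{v} C] {A : C} {X Y : Subobject A}
    (h : ∀ ⦃Z : C⦄ (g : Z ⟶ A), X.Factors g → Y.Factors g) : X ≤ Y := by
  have h1 : Y.Factors X.arrow :=
    h X.arrow (by simpa using X.factors_comp_arrow (𝟙 _))
  exact Subobject.le_of_comm (Y.factorThru _ h1) (by simp)

theorem eq_of_factors {C : Type u} [Category.{v} C] {A : C} {X Y : Subobject A}
    (h : ∀ ⦃Z : C⦄ (g : Z ⟶ A), X.Factors g ↔ Y.Factors g) : X = Y :=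
  le_antisymm (le_of_factors fun _ g => (h g).1) (le_of_factors fun _ g => (h g).2)

theorem factors_mk {C : Type u} [Category.{v} C] {A B Z : C} (m : B ⟶ A) [Mono m] (g : Z ⟶ A) :
    (Subobject.mk m).Factors g ↔ ∃ k : Z ⟶ B, k ≫ m = g :=
  Subobject.mk_factors_iff m g

theorem factors_ar {C : Type u} [Category.{v} C] {A Z : C} (X : Subobject A) (g : Z ⟶ A) :
    X.Factors g ↔ ∃ k : Z ⟶ (X : C), k ≫ X.arrow = g := by
  constructor
  · intro h
    exact ⟨X.factorThru g h, by simp⟩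
  · rintro ⟨k, rfl⟩
    exact X.factors_comp_arrow k

theorem factors_mono {C : Type u} [Category.{v} C] {A Z : C} {X Y : Subobject A} (hXY : X ≤ Y)
    (g : Z ⟶ A) (h : X.Factors g) : Y.Factors g := Subobject.factors_of_le g hXY h

theorem eta_epi {C : Type u} [Category.{v} C] (P : Pretorsion C) (A : C) {X : C}
    (u w : P.f A ⟶ X) (h : P.η A ≫ u = P.η A ≫ w) : u = w := by
  obtain ⟨ht, hu⟩ := (P.zexact A).2
  obtain ⟨D, a, b, hD, hab⟩ := ht
  have h1 : P.Trivial (P.ε A ≫ P.η A ≫ w) :=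
    ⟨D, a, b ≫ w, hD, by rw [← Category.assoc, hab, Category.assoc]⟩
  exact (hu (P.η A ≫ w) h1).unique h rfl

theorem eta_lift {C : Type u} [Category.{v} C] (P : Pretorsion C) {A X : C}
    (hX : X ∈ P.torsionFree) (m : A ⟶ X) : ∃ u : P.f A ⟶ X, P.η A ≫ u = m :=
  ((P.zexact A).2.2 m (P.pt1 (P.t_mem A) hX _)).exists

section
variable {C : Type u} [Category.{v} C] [HasInitial C] [InitialMonoClass C]

theorem distMono_arrow (cs : CoherentSystem C) {A : C} {S : Subobject A} (hS : cs.Dist S) :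
    cs.DistMono S.arrow := ⟨inferInstance, by rwa [Subobject.mk_arrow]⟩

theorem distMono_ofLE (cs : CoherentSystem C) {A : C} {S Q : Subobject A} (hS : cs.Dist S)
    (h : S ≤ Q) : cs.DistMono (Subobject.ofLE S Q h) := by
  refine ⟨inferInstance, ?_⟩
  obtain ⟨T, hT, hp⟩ := cs.preimage_exists Q.arrow hS
  have : Subobject.mk (Subobject.ofLE S Q h) = T := by
    apply eq_of_factors
    intro Z g
    rw [hp g, factors_mk, factors_ar]
    constructor
    · rintro ⟨k, rfl⟩
      exact ⟨k, by simp⟩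
    · rintro ⟨k, hk⟩
      exact ⟨k, by rw [← cancel_mono Q.arrow]; simp [hk]⟩
  rwa [this]

theorem inter_exists (cs : CoherentSystem C) {A : C} {S T : Subobject A} (hS : cs.Dist S)
    (hT : cs.Dist T) : ∃ J : Subobject A, cs.Dist J ∧
      ∀ ⦃Z : C⦄ (g : Z ⟶ A), J.Factors g ↔ S.Factors g ∧ T.Factors g := by
  obtain ⟨K, hK, hp⟩ := cs.preimage_exists S.arrow hT
  refine ⟨_, cs.dist_trans S K hS hK, fun Z g => ?_⟩
  rw [factors_mk]
  constructor
  · rintro ⟨k, rfl⟩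
    refine ⟨(factors_ar _ _).2 ⟨k ≫ K.arrow, by simp⟩, ?_⟩
    have := (hp (k ≫ K.arrow)).1 ((factors_ar _ _).2 ⟨k, rfl⟩)
    simpa using this
  · rintro ⟨h1, h2⟩
    obtain ⟨k, rfl⟩ := (factors_ar _ _).1 h1
    obtain ⟨l, rfl⟩ := (factors_ar _ _).1 ((hp k).2 h2)
    exact ⟨l, by simp⟩

theorem eta_distEpi (cs : CoherentSystem C) (P : Pretorsion C) (hc : Compatible cs P) (A : C) :
    cs.DistEpi (P.η A) := by
  refine hc.cc4 (𝟙 (P.f A)) ⟨inferInstance, ?_⟩ (𝟙 A) (P.η A) (IsPullback.of_vert_isIso ⟨by simp⟩)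
  have : Subobject.mk (𝟙 (P.f A)) = ⊤ := rfl
  rw [this]
  exact cs.dist_top _

theorem lemB (cs : CoherentSystem C) (P : Pretorsion C) (hc : Compatible cs P) {A : C}
    (W : Subobject (P.f A)) (hW : cs.Dist W) (Q : Subobject A) (hQ : cs.Dist Q)
    (hp : IsPreimage (P.η A) W Q) (ψ : P.f (Q : C) ⟶ P.f A)
    (hψ : P.η (Q : C) ≫ ψ = Q.arrow ≫ P.η A) (mψ : Mono ψ) : Subobject.mk ψ = W := by
  obtain ⟨_, hd⟩ := hc.cc3 Q.arrow (distMono_arrow cs hQ) ψ hψ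
  obtain ⟨v, hv⟩ := (factors_ar _ _).1 ((hp Q.arrow).1 ((factors_ar _ _).2 ⟨𝟙 _, by simp⟩))
  have pb : IsPullback v Q.arrow W.arrow (P.η A) := by
    refine ⟨⟨hv⟩, ⟨PullbackCone.IsLimit.mk _
      (fun s => Q.factorThru s.snd ((hp s.snd).2 ((factors_ar _ _).2 ⟨s.fst, s.condition⟩)))
      ?_ ?_ ?_⟩⟩
    · intro s
      rw [← cancel_mono W.arrow, Category.assoc, hv, ← Category.assoc,
        Subobject.factorThru_arrow, s.condition]
    · intro s
      simp
    · intro s m _ h2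
      rw [← cancel_mono Q.arrow, h2]
      simp
  have he := hc.cc4 W.arrow (distMono_arrow cs hW) _ _ pb
  apply le_antisymm
  · obtain ⟨T, hT, hTp⟩ := cs.preimage_exists ψ hW
    have ht := (eta_distEpi cs P hc (Q : C)).2 T hT
      ((hTp _).2 ((factors_ar _ _).2 ⟨v, by rw [hψ, hv]⟩))
    have h1 := (hTp (𝟙 _)).1 (ht ▸ Subobject.top_factors _)
    rw [Category.id_comp] at h1
    obtain ⟨k, hk⟩ := (factors_ar _ _).1 h1
    exact Subobject.mk_le_of_comm k hk
  · obtain ⟨T, hT, hTp⟩ := cs.preimage_exists W.arrow hd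
    have ht := he.2 T hT ((hTp _).2 ((factors_mk _ _).2 ⟨P.η _, by rw [hψ, hv]⟩))
    have h1 := (hTp (𝟙 _)).1 (ht ▸ Subobject.top_factors _)
    rw [Category.id_comp] at h1
    obtain ⟨k, hk⟩ := (factors_mk _ _).1 h1
    exact Subobject.le_mk_of_comm k hk

theorem lemA (cs : CoherentSystem C) (P : Pretorsion C) (hc : Compatible cs P) {A : C}
    (S : Subobject A) (hS : cs.Dist S) (σ : P.f (S : C) ⟶ P.f A)
    (hσ : P.η (S : C) ≫ σ = S.arrow ≫ P.η A) (mσ : Mono σ) :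
    cs.Dist (Subobject.mk σ) ∧ IsPreimage (P.η A) (Subobject.mk σ) S := by
  obtain ⟨_, hd⟩ := hc.cc3 S.arrow (distMono_arrow cs hS) σ hσ
  refine ⟨hd, ?_⟩
  obtain ⟨Q, hQ, hp⟩ := cs.preimage_exists (P.η A) hd
  have hSQ : S ≤ Q := by
    apply le_of_factors
    intro Z g hg
    obtain ⟨k, rfl⟩ := (factors_ar _ _).1 hg
    exact (hp _).2 ((factors_mk _ _).2 ⟨k ≫ P.η _, by simp [hσ]⟩)
  obtain ⟨v, hv⟩ := (factors_mk _ _).1 ((hp Q.arrow).1 ((factors_ar _ _).2 ⟨𝟙 _, by simp⟩))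
  obtain ⟨w, hw⟩ := eta_lift P (P.f_mem (S : C)) v
  obtain ⟨π, hπ⟩ := eta_lift P (P.f_mem A) (Q.arrow ≫ P.η A)
  obtain ⟨mπ, -⟩ := hc.cc3 Q.arrow (distMono_arrow cs hQ) π hπ
  obtain ⟨θ, hθ⟩ := eta_lift P (P.f_mem (Q : C)) (Subobject.ofLE S Q hSQ ≫ P.η (Q : C))
  have hθπ : θ ≫ π = σ := by
    apply eta_epi
    rw [← Category.assoc, hθ, Category.assoc, hπ, hσ]
    simp
  have hwσ : w ≫ σ = π := by
    apply eta_epi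
    rw [← Category.assoc, hw, hv, hπ]
  have hiso : IsIso θ := by
    refine ⟨w, ?_, ?_⟩
    · rw [← cancel_mono σ]
      simp [hwσ, hθπ]
    · rw [← cancel_mono π]
      simp [hwσ, hθπ]
  have := hc.cc5 _ (distMono_ofLE cs hS hSQ) θ hθ hiso
  have hQS : Q ≤ S := Subobject.le_of_comm (inv (Subobject.ofLE S Q hSQ)) (by simp)
  exact fun Z g => ⟨fun h => (hp g).1 (factors_mono hSQ g h),
    fun h => factors_mono hQS g ((hp g).2 h)⟩

end

/-- Corollary 4.11: the functor `φ` preserves unions and intersections of distinguished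
subobjects. -/
theorem statement10 {C : Type u} [Category.{v} C] [HasInitial C] [HasStrictInitialObjects C]
    (cs : CoherentSystem C) (P : Pretorsion C) (hc : Compatible cs P)
    {A : C} (R S : Subobject A) (hR : cs.Dist R) (hS : cs.Dist S)
    (U I : Subobject A) (hU : IsUnion S R U) (hI : IsInter S R I)
    (ρ : P.f (R : C) ⟶ P.f A) (hρ : P.η (R : C) ≫ ρ = R.arrow ≫ P.η A) (mρ : Mono ρ)
    (σ : P.f (S : C) ⟶ P.f A) (hσ : P.η (S : C) ≫ σ = S.arrow ≫ P.η A) (mσ : Mono σ)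
    (υ : P.f (U : C) ⟶ P.f A) (hυ : P.η (U : C) ≫ υ = U.arrow ≫ P.η A) (mυ : Mono υ)
    (ι : P.f (I : C) ⟶ P.f A) (hι : P.η (I : C) ≫ ι = I.arrow ≫ P.η A) (mι : Mono ι) :
    IsUnion (@Subobject.mk _ _ _ _ σ mσ) (@Subobject.mk _ _ _ _ ρ mρ)
      (@Subobject.mk _ _ _ _ υ mυ) ∧
    IsInter (@Subobject.mk _ _ _ _ σ mσ) (@Subobject.mk _ _ _ _ ρ mρ)
      (@Subobject.mk _ _ _ _ ι mι) := by
  obtain ⟨dσ, pσ⟩ := lemA cs P hc S hS σ hσ mσ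
  obtain ⟨dρ, pρ⟩ := lemA cs P hc R hR ρ hρ mρ
  constructor
  · obtain ⟨V, hV, hVu⟩ := cs.union_exists dσ dρ
    obtain ⟨Q, hQ, hQp⟩ := cs.preimage_exists (P.η A) hV
    have hu := cs.preimage_union (P.η A) dσ dρ hVu pσ pρ hQp
    have hUQ : Q = U := le_antisymm (hu.2.2 U hU.1 hU.2.1) (hU.2.2 Q hu.1 hu.2.1)
    subst hUQ
    rw [lemB cs P hc V hV Q hQ hQp υ hυ mυ]
    exact hVu
  · obtain ⟨K, hK, hKf⟩ := inter_exists cs hS hR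
    obtain ⟨J, hJ, hJf⟩ := inter_exists cs dσ dρ
    have hIK : I = K := by
      apply le_antisymm
      · exact le_of_factors fun Z g hg =>
          (hKf g).2 ⟨factors_mono hI.1 g hg, factors_mono hI.2.1 g hg⟩
      · exact hI.2.2 K (le_of_factors fun Z g hg => ((hKf g).1 hg).1)
          (le_of_factors fun Z g hg => ((hKf g).1 hg).2)
    subst hIK
    have hp : IsPreimage (P.η A) J I := fun Z g => by rw [hKf, hJf, pσ g, pρ g]
    rw [lemB cs P hc J hJ I hK hp ι hι mι]
    exact ⟨le_of_factors fun Z g hg => ((hJf g).1 hg).1,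
      le_of_factors fun Z g hg => ((hJf g).1 hg).2,
      fun V h1 h2 => le_of_factors fun Z g hg =>
        (hJf g).2 ⟨factors_mono h1 g hg, factors_mono h2 g hg⟩⟩

end CoherentPaper
end

section
/- Let E be a category with a strict initial object, equipped with a pretorsion theory and a coherent system of subobjects which are compatible. Consider a commutative diagram whose bottom row is the canonical short Z-exact sequence τ(A) →ε_A A →η_A φ(A), whose vertical morphisms x: X ↪ τ(A), s: S ↪ A, y: Y ↪ φ(A) are distinguished monomorphisms, whose top row is X →k S →p Y, and in which both squares are pullbacks. Then the top row X →k S →p Y is a canonical short Z-exact sequence for S: there are isomorphisms X ≅ τ(S) and Y ≅ φ(S) identifying k with ε_S and p with η_S; in particular X is torsion, Y is torsion-free, k is a Z-kernel of p and p is a Z-cokernel of k. -/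
open CategoryTheory CategoryTheory.Limits

universe w v u v' u'

namespace CoherentPaper
/-- Proposition 4.12: pulling back the canonical short Z-exact sequence of `A` along a
distinguished subobject `S` of `A` yields the canonical short Z-exact sequence of `S`. -/
theorem statement11 {C : Type u} [Category.{v} C] [HasInitial C] [HasStrictInitialObjects C]
    (cs : CoherentSystem C) (P : Pretorsion C) (hc : Compatible cs P)
    {X S A Y : C} (s : S ⟶ A) (hs : cs.DistMono s)
    (x : X ⟶ P.t A) (hx : cs.DistMono x) (y : Y ⟶ P.f A) (hy : cs.DistMono y)
    (k : X ⟶ S) (p : S ⟶ Y)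
    (sq1 : IsPullback k x s (P.ε A)) (sq2 : IsPullback p s y (P.η A)) :
    (∃ i : X ≅ P.t S, i.hom ≫ P.ε S = k) ∧
    (∃ j : Y ≅ P.f S, p ≫ j.hom = P.η S) ∧
    X ∈ P.torsion ∧ Y ∈ P.torsionFree ∧ P.ShortZExact k p := by
  have fac : ∀ {B D E : C} (m : B ⟶ D) [Mono m] (g : E ⟶ D),
      (Subobject.mk m).Factors g ↔ ∃ u : E ⟶ B, u ≫ m = g :=
    fun m _ g => Subobject.mk_factors_iff m g
  have εmono : ∀ B : C, Mono (P.ε B) := fun B => ⟨fun {Z} a b h => by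
    have htriv : P.Trivial ((a ≫ P.ε B) ≫ P.η B) := by
      obtain ⟨D, u, v, hD, e⟩ := (P.zexact B).1.1
      exact ⟨D, a ≫ u, v, hD, by rw [Category.assoc, e, Category.assoc]⟩
    exact ((P.zexact B).1.2 _ htriv).unique rfl h.symm⟩
  obtain ⟨ψ, hψ, -⟩ := (P.zexact S).2.2 (s ≫ P.η A)
    (P.pt1 (P.t_mem S) (P.f_mem A) _)
  have hψ : P.η S ≫ ψ = s ≫ P.η A := hψ
  obtain ⟨ψm, ψd⟩ := hc.cc3 s hs ψ hψ
  obtain ⟨ym, yd⟩ := id hy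
  have pepi := hc.cc4 y hy s p sq2
  have ηepi : cs.DistEpi (P.η S) := by
    refine hc.cc4 (𝟙 (P.f S)) ⟨inferInstance, ?_⟩ (𝟙 S) (P.η S) ?_
    · have := cs.dist_top (P.f S)
      rwa [Subobject.top_eq_id] at this
    · exact IsPullback.of_vert_isIso ⟨by simp⟩
  -- y factors through ψ
  have hyψ : (Subobject.mk ψ).Factors y := by
    obtain ⟨R, hR, hR2⟩ := cs.preimage_exists y ψd
    have : R = ⊤ := pepi.2 R hR ((hR2 p).2 (by
      rw [sq2.w, ← hψ]; exact (fac _ _).2 ⟨P.η S, rfl⟩))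
    have h := (hR2 (𝟙 Y)).1 (by rw [this]; exact Subobject.top_factors _)
    simpa using h
  obtain ⟨w, hw⟩ := (fac _ _).1 hyψ
  have hw : w ≫ ψ = y := hw
  have hpw : p ≫ w = P.η S := by
    rw [← cancel_mono ψ, Category.assoc, hw, hψ, sq2.w]
  have wmono : Mono w := by
    have : Mono (w ≫ ψ) := by rw [hw]; exact ym
    exact mono_of_mono w ψ
  have wiso : IsIso w := by
    obtain ⟨R, hR, hR2⟩ := cs.preimage_exists ψ yd
    have : R = ⊤ := ηepi.2 R hR ((hR2 _).2 (by
      rw [hψ, ← sq2.w]; exact (fac _ _).2 ⟨p, rfl⟩))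
    have h := (hR2 (𝟙 _)).1 (by rw [this]; exact Subobject.top_factors _)
    obtain ⟨r, hr⟩ := (fac _ _).1 h
    have hr : r ≫ y = 𝟙 _ ≫ ψ := hr
    have h1 : r ≫ w = 𝟙 _ := by
      rw [← cancel_mono ψ, Category.assoc, hw, hr]
    exact ⟨r, by rw [← cancel_mono w, Category.assoc, h1]; simp, h1⟩
  have trivL : ∀ {B D E : C} (g : B ⟶ D) (h : D ⟶ E), P.Trivial g → P.Trivial (g ≫ h) := by
    rintro B D E g h ⟨Z, u, v, hZ, e⟩
    exact ⟨Z, u, v ≫ h, hZ, by rw [e, Category.assoc]⟩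
  have trivR : ∀ {B D E : C} (g : B ⟶ D) (h : D ⟶ E), P.Trivial h → P.Trivial (g ≫ h) := by
    rintro B D E g h ⟨Z, u, v, hZ, e⟩
    exact ⟨Z, g ≫ u, v, hZ, by rw [e, Category.assoc]⟩
  have kp : P.Trivial (k ≫ p) := by
    obtain ⟨D, u, v, hD, e⟩ := trivR x _ (P.zexact A).1.1
    obtain ⟨R, hR, hR2⟩ := cs.preimage_exists v yd
    have e2 : (k ≫ p) ≫ y = u ≫ v := by
      rw [← e, Category.assoc, sq2.w, ← Category.assoc, sq1.w, Category.assoc]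
    have hu : R.Factors u := (hR2 u).2 (by
      rw [← e2]; exact (fac _ _).2 ⟨k ≫ p, rfl⟩)
    have hv := (hR2 R.arrow).1 (Subobject.factors_of_factors_right (P := R) (𝟙 _) (by
      exact Subobject.factors_self R) |> fun h => by simpa using h)
    obtain ⟨r, hr⟩ := (fac _ _).1 hv
    have hr : r ≫ y = R.arrow ≫ v := hr
    refine ⟨(R : C), R.factorThru u hu, r, hc.cc1 R hD hR, ?_⟩
    rw [← cancel_mono y, e2, Category.assoc, hr, ← Category.assoc, Subobject.factorThru_arrow]
  have kmono : Mono k := ⟨fun a b h => by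
    apply sq1.hom_ext h
    have := εmono A
    rw [← cancel_mono (P.ε A), Category.assoc, Category.assoc, ← sq1.w,
      ← Category.assoc, h, Category.assoc]⟩
  have kker : P.IsZKernel k p := by
    refine ⟨kp, fun M m hm => ?_⟩
    have h1 : P.Trivial ((m ≫ s) ≫ P.η A) := by
      rw [Category.assoc, ← sq2.w, ← Category.assoc]; exact trivL _ _ hm
    obtain ⟨u, hu, -⟩ := (P.zexact A).1.2 _ h1
    have hu : u ≫ P.ε A = m ≫ s := hu
    refine ⟨sq1.lift m u hu.symm, sq1.lift_fst _ _ _, fun z hz => ?_⟩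
    rw [← cancel_mono k, sq1.lift_fst]; exact hz
  have hpη : p = P.η S ≫ inv w := by rw [← hpw]; simp
  have εp : P.Trivial (P.ε S ≫ p) := by
    rw [hpη, ← Category.assoc]; exact trivL _ _ (P.zexact S).1.1
  obtain ⟨a, ha, -⟩ := kker.2 _ εp
  have ha : a ≫ k = P.ε S := ha
  obtain ⟨b, hb, -⟩ := (P.zexact S).1.2 k (by
    rw [← hpw, ← Category.assoc]; exact trivL _ _ kp)
  have hb : b ≫ P.ε S = k := hb
  have := εmono S
  let i : X ≅ P.t S := ⟨b, a, by rw [← cancel_mono k, Category.assoc, ha, hb]; simp,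
    by rw [← cancel_mono (P.ε S), Category.assoc, hb, ha]; simp⟩
  refine ⟨⟨i, hb⟩, ⟨asIso w, hpw⟩, P.torsion_iso_closed i.symm (P.t_mem S),
    P.torsionFree_iso_closed (asIso w).symm (P.f_mem S), kker, kp, fun M m hm => ?_⟩
  obtain ⟨u, hu, -⟩ := (P.zexact S).2.2 m (by
    rw [← ha, Category.assoc]; exact trivR _ _ hm)
  have hu : P.η S ≫ u = m := hu
  have := pepi.1
  refine ⟨w ≫ u, by rw [← hu, ← hpw, Category.assoc], fun z hz => ?_⟩
  rw [← cancel_epi p, ← Category.assoc, hpw, hu]; exact hz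

end CoherentPaper
end

section
/- Let E be a category with a strict initial object, equipped with a pretorsion theory whose initial object is a trivial object. Then there exists a category S equipped with a torsion theory, together with a torsion functor σ: E → S, which is universal: for every category X equipped with a torsion theory and every torsion functor F: E → X, there exists a unique functor G: S → X with G ∘ σ = F, and this G is a torsion functor. -/
open CategoryTheory CategoryTheory.Limits

universe w v u v' u'

namespace CoherentPaper
section Helpers

variable {C : Type u} [Category.{v} C]

theorem triv_left (P : PretorsionData C) {X Y Z : C} (f : X ⟶ Y) {g : Y ⟶ Z}
    (h : P.Trivial g) : P.Trivial (f ≫ g) := by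
  obtain ⟨D, a, b, hD, rfl⟩ := h
  exact ⟨D, f ≫ a, b, hD, by simp⟩

theorem triv_right (P : PretorsionData C) {X Y Z : C} {f : X ⟶ Y} (g : Y ⟶ Z)
    (h : P.Trivial f) : P.Trivial (f ≫ g) := by
  obtain ⟨D, a, b, hD, rfl⟩ := h
  exact ⟨D, a, b ≫ g, hD, by simp⟩

theorem triv_src (P : PretorsionData C) {X Y : C} (h : P.TrivialObj X) (f : X ⟶ Y) :
    P.Trivial f := ⟨X, 𝟙 X, f, h, by simp⟩

theorem triv_tgt (P : PretorsionData C) {X Y : C} (h : P.TrivialObj Y) (f : X ⟶ Y) :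
    P.Trivial f := ⟨Y, f, 𝟙 Y, h, by simp⟩

theorem trivObj_of_id (P : Pretorsion C) {A : C} (h : P.Trivial (𝟙 A)) : P.TrivialObj A := by
  have hη : P.Trivial (𝟙 A ≫ P.η A) := triv_right _ _ h
  have hε : P.Trivial (P.ε A ≫ 𝟙 A) := triv_left _ _ h
  obtain ⟨⟨h1, h2⟩, ⟨h3, h4⟩⟩ := P.zexact A
  obtain ⟨s, hs, -⟩ := h2 _ hη
  obtain ⟨r, hr, -⟩ := h4 _ hε
  have e1 : P.ε A ≫ s = 𝟙 _ := (h2 (P.ε A) h1).unique (by simp [hs]) (by simp)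
  have e2 : r ≫ P.η A = 𝟙 _ := (h4 (P.η A) h1).unique
    (by rw [← Category.assoc, hr]; simp) (by simp)
  exact ⟨P.torsion_iso_closed ⟨P.ε A, s, e1, hs⟩ (P.t_mem A),
    P.torsionFree_iso_closed ⟨r, P.η A, e2, hr⟩ (P.f_mem A)⟩

theorem triv_of_comp_ε (P : Pretorsion C) {X A : C} (w : X ⟶ P.t A)
    (h : P.Trivial (w ≫ P.ε A)) : P.Trivial w := by
  obtain ⟨D, a, b, hD, e⟩ := h
  obtain ⟨⟨h1, h2⟩, -⟩ := P.zexact A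
  obtain ⟨c, hc, -⟩ := h2 b (P.pt1 hD.1 (P.f_mem A) _)
  have : w = a ≫ c := (h2 (w ≫ P.ε A) (by
    rw [e, Category.assoc]; exact triv_left _ _ (triv_src _ hD _))).unique rfl
      (by rw [Category.assoc, hc, e])
  exact ⟨D, a, c, hD, this⟩

theorem triv_of_η_comp (P : Pretorsion C) {X A : C} (w : P.f A ⟶ X)
    (h : P.Trivial (P.η A ≫ w)) : P.Trivial w := by
  obtain ⟨D, a, b, hD, e⟩ := h
  obtain ⟨-, ⟨h1, h2⟩⟩ := P.zexact A
  obtain ⟨c, hc, -⟩ := h2 a (P.pt1 (P.t_mem A) hD.2 _)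
  have : w = c ≫ b := (h2 (P.η A ≫ w) (by
    rw [e, ← Category.assoc]; exact triv_right _ _ (triv_tgt _ hD _))).unique rfl
      (by rw [← Category.assoc, hc, e])
  exact ⟨D, c, b, hD, this⟩

/-- Morphisms together with a formal zero. -/
inductive Raw (A B : C) : Type (max u v) where
  | zero : Raw A B
  | of (f : A ⟶ B) : Raw A B

def Raw.IsZ (P : Pretorsion C) {A B : C} : Raw A B → Prop
  | .zero => True
  | .of f => P.Trivial f

def Raw.comp {A B D : C} : Raw A B → Raw B D → Raw A D
  | .of f, .of g => .of (f ≫ g)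
  | _, _ => .zero

theorem Raw.isZ_left (P : Pretorsion C) {A B D : C} (x : Raw A B) (y : Raw B D)
    (h : y.IsZ P) : (x.comp y).IsZ P := by
  cases x <;> cases y <;> first | trivial | exact triv_left _ _ h

theorem Raw.isZ_right (P : Pretorsion C) {A B D : C} (x : Raw A B) (y : Raw B D)
    (h : x.IsZ P) : (x.comp y).IsZ P := by
  cases x <;> cases y <;> first | trivial | exact triv_right _ _ h

def rawSetoid (P : Pretorsion C) (A B : C) : Setoid (Raw A B) where
  r x y := x = y ∨ (x.IsZ P ∧ y.IsZ P)
  iseqv := by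
    refine ⟨fun x => Or.inl rfl, ?_, ?_⟩
    · rintro x y (rfl | ⟨h, h'⟩)
      · exact Or.inl rfl
      · exact Or.inr ⟨h', h⟩
    · rintro x y z (rfl | ⟨h, h'⟩) (rfl | ⟨k, k'⟩)
      · exact Or.inl rfl
      · exact Or.inr ⟨k, k'⟩
      · exact Or.inr ⟨h, h'⟩
      · exact Or.inr ⟨h, k'⟩

structure SObj (P : Pretorsion C) : Type u where
  as : C

def SHom (P : Pretorsion C) (A B : C) : Type (max u v) := Quotient (rawSetoid P A B)

def SHom.mk (P : Pretorsion C) {A B : C} (x : Raw A B) : SHom P A B :=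
  Quotient.mk (rawSetoid P A B) x

theorem SHom.mk_eq (P : Pretorsion C) {A B : C} {x y : Raw A B} :
    SHom.mk P x = SHom.mk P y ↔ (x = y ∨ (x.IsZ P ∧ y.IsZ P)) :=
  ⟨fun h => Quotient.exact h, fun h => Quotient.sound h⟩

theorem SHom.mk_eq_zero (P : Pretorsion C) {A B : C} {x : Raw A B} :
    SHom.mk P x = SHom.mk P .zero ↔ x.IsZ P := by
  rw [SHom.mk_eq]
  constructor
  · rintro (rfl | h)
    · trivial
    · exact h.1
  · intro h
    exact Or.inr ⟨h, trivial⟩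

theorem SHom.mk_surj (P : Pretorsion C) {A B : C} (x : SHom P A B) :
    ∃ y, SHom.mk P y = x := Quotient.exists_rep x

def SHom.comp (P : Pretorsion C) {A B D : C} : SHom P A B → SHom P B D → SHom P A D :=
  Quotient.map₂ Raw.comp (by
    rintro x x' (rfl | ⟨h, h'⟩) y y' (rfl | ⟨k, k'⟩)
    · exact Or.inl rfl
    · exact Or.inr ⟨Raw.isZ_left _ _ _ k, Raw.isZ_left _ _ _ k'⟩
    · exact Or.inr ⟨Raw.isZ_right _ _ _ h, Raw.isZ_right _ _ _ h'⟩
    · exact Or.inr ⟨Raw.isZ_right _ _ _ h, Raw.isZ_right _ _ _ h'⟩)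

theorem SHom.comp_mk (P : Pretorsion C) {A B D : C} (x : Raw A B) (y : Raw B D) :
    SHom.comp P (SHom.mk P x) (SHom.mk P y) = SHom.mk P (x.comp y) := rfl

instance sCat (P : Pretorsion C) : Category.{max u v} (SObj P) where
  Hom A B := SHom P A.as B.as
  id A := SHom.mk P (Raw.of (𝟙 A.as))
  comp f g := SHom.comp P f g
  id_comp f := by
    obtain ⟨x, rfl⟩ := SHom.mk_surj P f
    rw [SHom.comp_mk]
    cases x <;> simp [Raw.comp]
  comp_id f := by
    obtain ⟨x, rfl⟩ := SHom.mk_surj P f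
    rw [SHom.comp_mk]
    cases x <;> simp [Raw.comp]
  assoc f g h := by
    obtain ⟨x, rfl⟩ := SHom.mk_surj P f
    obtain ⟨y, rfl⟩ := SHom.mk_surj P g
    obtain ⟨z, rfl⟩ := SHom.mk_surj P h
    simp only [SHom.comp_mk]
    cases x <;> cases y <;> cases z <;> simp [Raw.comp]

/-- The object of `S` attached to an object of `C`. -/
abbrev ob (P : Pretorsion C) (A : C) : SObj P := ⟨A⟩

def smk (P : Pretorsion C) {A B : C} (x : Raw A B) : ob P A ⟶ ob P B := SHom.mk P x

theorem smk_surj (P : Pretorsion C) {A B : C} (f : ob P A ⟶ ob P B) :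
    ∃ x, smk P x = f := SHom.mk_surj P f

theorem smk_comp (P : Pretorsion C) {A B D : C} (x : Raw A B) (y : Raw B D) :
    smk P x ≫ smk P y = smk P (x.comp y) := rfl

theorem smk_id (P : Pretorsion C) (A : C) : 𝟙 (ob P A) = smk P (Raw.of (𝟙 A)) := rfl

theorem smk_eq (P : Pretorsion C) {A B : C} {x y : Raw A B} :
    smk P x = smk P y ↔ (x = y ∨ (x.IsZ P ∧ y.IsZ P)) := SHom.mk_eq P

theorem smk_eq_zero (P : Pretorsion C) {A B : C} {x : Raw A B} :
    smk P x = smk P .zero ↔ x.IsZ P := SHom.mk_eq_zero P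

def sσ (P : Pretorsion C) : C ⥤ SObj P where
  obj A := ob P A
  map f := smk P (Raw.of f)
  map_id _ := rfl
  map_comp _ _ := rfl

theorem s_iso (P : Pretorsion C) {A B : C} (i : ob P A ≅ ob P B) :
    P.TrivialObj B ∨ Nonempty (A ≅ B) := by
  obtain ⟨x, hx⟩ := smk_surj P i.hom
  obtain ⟨y, hy⟩ := smk_surj P i.inv
  have h1 := i.hom_inv_id
  have h2 := i.inv_hom_id
  rw [← hx, ← hy, smk_comp, smk_id, smk_eq] at h1 h2
  rcases h2 with h2 | h2
  · cases x with
    | zero => cases y <;> simp [Raw.comp] at h2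
    | of f =>
      cases y with
      | zero => simp [Raw.comp] at h2
      | of g =>
        simp only [Raw.comp, Raw.of.injEq] at h1 h2
        rcases h1 with h1 | h1
        · exact Or.inr ⟨⟨f, g, h1, h2⟩⟩
        · left
          apply trivObj_of_id
          rw [← h2, ← Category.id_comp f]
          exact triv_left _ _ (triv_right _ _ h1.2)
  · exact Or.inl (trivObj_of_id P h2.2)

def sData (P : Pretorsion C) : PretorsionData (SObj P) where
  torsion := {A | A.as ∈ P.torsion}
  torsionFree := {A | A.as ∈ P.torsionFree}
  torsion_iso_closed := by
    rintro ⟨X⟩ ⟨Y⟩ i h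
    rcases s_iso P (A := X) (B := Y) i with h' | ⟨⟨j⟩⟩
    · exact h'.1
    · exact P.torsion_iso_closed j h
  torsionFree_iso_closed := by
    rintro ⟨X⟩ ⟨Y⟩ i h
    rcases s_iso P (A := X) (B := Y) i with h' | ⟨⟨j⟩⟩
    · exact h'.2
    · exact P.torsionFree_iso_closed j h
  t A := ob P (P.t A.as)
  f A := ob P (P.f A.as)
  ε A := (sσ P).map (P.ε A.as)
  η A := (sσ P).map (P.η A.as)

theorem s_triv (P : Pretorsion C) {D : C} (hD : P.TrivialObj D) {A B : C} (x : Raw A B) :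
    (sData P).Trivial (smk P x) ↔ x.IsZ P := by
  rw [← smk_eq_zero]
  constructor
  · rintro ⟨⟨E⟩, a, b, hE, e⟩
    obtain ⟨a, rfl⟩ := smk_surj P (B := E) a
    obtain ⟨b, rfl⟩ := smk_surj P (A := E) b
    have := e.trans (smk_comp P a b)
    rw [this, smk_eq_zero]
    apply Raw.isZ_left
    cases b
    · trivial
    · exact triv_src P.toPretorsionData hE _
  · intro h
    exact ⟨ob P D, smk P .zero, smk P .zero, hD, h⟩

theorem s_exact (P : Pretorsion C) {D : C} (hD : P.TrivialObj D) (A : C) :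
    (sData P).ShortZExact (smk P (.of (P.ε A))) (smk P (.of (P.η A))) := by
  obtain ⟨⟨h1, h2⟩, ⟨-, h4⟩⟩ := P.zexact A
  have h0 : (sData P).Trivial (smk P (.of (P.ε A)) ≫ smk P (.of (P.η A))) := by
    rw [smk_comp, s_triv P hD]
    exact h1
  refine ⟨⟨h0, ?_⟩, ⟨h0, ?_⟩⟩
  · rintro ⟨X⟩ m hm
    obtain ⟨m, rfl⟩ := smk_surj P (A := X) m
    have huniq : ∀ w : Raw X (P.t A), (w.comp (.of (P.ε A))).IsZ P → w.IsZ P := by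
      intro w hw
      cases w
      · trivial
      · exact triv_of_comp_ε P _ hw
    have hm' := (s_triv P hD _).1 hm
    have hex : ∃ w : Raw X (P.t A), w.comp (.of (P.ε A)) = m := by
      cases m with
      | zero => exact ⟨.zero, rfl⟩
      | of m =>
        obtain ⟨c, hc, -⟩ := h2 m hm'
        exact ⟨.of c, congrArg Raw.of hc⟩
    obtain ⟨w, hw⟩ := hex
    refine ⟨smk P w, by subst hw; rfl, ?_⟩
    intro w' hw'
    obtain ⟨w', rfl⟩ := smk_surj P (A := X) w'
    have hw2 := (smk_eq P).1 hw'
    refine (smk_eq P).2 ?_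
    rcases hw2 with e | ⟨e1, e2⟩
    · cases w with
      | zero =>
        cases w' with
        | zero => exact Or.inl rfl
        | of w' => subst hw; simp [Raw.comp] at e
      | of w =>
        cases w' with
        | zero => subst hw; simp [Raw.comp] at e
        | of w' =>
          subst hw
          left
          simp only [Raw.comp, Raw.of.injEq] at e
          exact congrArg Raw.of ((h2 _ hm').unique e rfl)
    · exact Or.inr ⟨huniq _ e1, huniq _ (hw ▸ e2)⟩
  · rintro ⟨X⟩ m hm
    obtain ⟨m, rfl⟩ := smk_surj P (B := X) m
    have huniq : ∀ w : Raw (P.f A) X, (Raw.comp (.of (P.η A)) w).IsZ P → w.IsZ P := by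
      intro w hw
      cases w
      · trivial
      · exact triv_of_η_comp P _ hw
    have hm' := (s_triv P hD _).1 hm
    have hex : ∃ w : Raw (P.f A) X, Raw.comp (.of (P.η A)) w = m := by
      cases m with
      | zero => exact ⟨.zero, rfl⟩
      | of m =>
        obtain ⟨c, hc, -⟩ := h4 m hm'
        exact ⟨.of c, congrArg Raw.of hc⟩
    obtain ⟨w, hw⟩ := hex
    refine ⟨smk P w, by subst hw; rfl, ?_⟩
    intro w' hw'
    obtain ⟨w', rfl⟩ := smk_surj P (B := X) w'
    have hw2 := (smk_eq P).1 hw'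
    refine (smk_eq P).2 ?_
    rcases hw2 with e | ⟨e1, e2⟩
    · cases w with
      | zero =>
        cases w' with
        | zero => exact Or.inl rfl
        | of w' => subst hw; simp [Raw.comp] at e
      | of w =>
        cases w' with
        | zero => subst hw; simp [Raw.comp] at e
        | of w' =>
          subst hw
          left
          simp only [Raw.comp, Raw.of.injEq] at e
          exact congrArg Raw.of ((h4 _ hm').unique e rfl)
    · exact Or.inr ⟨huniq _ e1, huniq _ (hw ▸ e2)⟩

def sPre (P : Pretorsion C) {D : C} (hD : P.TrivialObj D) : Pretorsion (SObj P) where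
  toPretorsionData := sData P
  pt1 := by
    rintro ⟨A⟩ ⟨B⟩ hA hB g
    obtain ⟨x, rfl⟩ := smk_surj P (A := A) (B := B) g
    refine (s_triv P hD x).2 ?_
    cases x
    · trivial
    · exact P.pt1 hA hB _
  t_mem A := P.t_mem A.as
  f_mem A := P.f_mem A.as
  zexact A := s_exact P hD A.as

theorem s_isZero (P : Pretorsion C) {A : C} (hA : P.TrivialObj A) : IsZero (ob P A) := by
  constructor
  · rintro ⟨Y⟩
    refine ⟨⟨⟨smk P .zero⟩, ?_⟩⟩
    intro g
    obtain ⟨x, rfl⟩ := smk_surj P (B := Y) g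
    refine (smk_eq_zero P).2 ?_
    cases x
    · trivial
    · exact triv_src _ hA _
  · rintro ⟨Y⟩
    refine ⟨⟨⟨smk P .zero⟩, ?_⟩⟩
    intro g
    obtain ⟨x, rfl⟩ := smk_surj P (A := Y) g
    refine (smk_eq_zero P).2 ?_
    cases x
    · trivial
    · exact triv_tgt _ hA _

section Lift

variable {X : Type u'} [Category.{v'} X] (F : C ⥤ X) {D : C} (hZ : IsZero (F.obj D))

/-- the map through the zero object `F D` -/
noncomputable def zmap (A B : X) : A ⟶ B := hZ.from_ A ≫ hZ.to_ B

theorem zmap_eq {E : X} (hE : IsZero E) {A B : X} (a : A ⟶ E) (b : E ⟶ B) :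
    a ≫ b = zmap F hZ A B := by
  have e1 : a = hZ.from_ A ≫ hZ.to_ E := hE.eq_of_tgt _ _
  have e2 : hZ.to_ E ≫ b = hZ.to_ B := hZ.eq_of_src _ _
  rw [e1, Category.assoc, e2, zmap]

noncomputable def rawMap {A B : C} : Raw A B → (F.obj A ⟶ F.obj B)
  | .zero => zmap F hZ _ _
  | .of f => F.map f

theorem rawMap_z (P : Pretorsion C) (hF : ∀ E, P.TrivialObj E → IsZero (F.obj E))
    {A B : C} (x : Raw A B) (h : x.IsZ P) : rawMap F hZ x = zmap F hZ _ _ := by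
  cases x with
  | zero => rfl
  | of f =>
    obtain ⟨E, a, b, hE, rfl⟩ := h
    simp only [rawMap, F.map_comp]
    exact zmap_eq F hZ (hF E hE) _ _

noncomputable def sLift (P : Pretorsion C) (hF : ∀ E, P.TrivialObj E → IsZero (F.obj E)) :
    SObj P ⥤ X where
  obj A := F.obj A.as
  map {A B} f := Quotient.lift (s := rawSetoid P A.as B.as) (rawMap F hZ) (by
    rintro x y (rfl | ⟨h, h'⟩)
    · rfl
    · rw [rawMap_z F hZ P hF x h, rawMap_z F hZ P hF y h']) f
  map_id A := F.map_id A.as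
  map_comp := by
    rintro ⟨A⟩ ⟨B⟩ ⟨E⟩ f g
    obtain ⟨x, rfl⟩ := smk_surj P (A := A) (B := B) f
    obtain ⟨y, rfl⟩ := smk_surj P (A := B) (B := E) g
    change rawMap F hZ (x.comp y) = rawMap F hZ x ≫ rawMap F hZ y
    cases x with
    | zero =>
      have : zmap F hZ (F.obj A) (F.obj B) ≫ rawMap F hZ y = zmap F hZ _ _ := by
        rw [zmap, Category.assoc]
        exact zmap_eq F hZ hZ _ _
      cases y <;> exact this.symm
    | of f =>
      cases y with
      | zero =>
        have : F.map f ≫ zmap F hZ (F.obj B) (F.obj E) = zmap F hZ _ _ := by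
          rw [zmap, ← Category.assoc]
          exact zmap_eq F hZ hZ _ _
        exact this.symm
      | of g => exact F.map_comp f g

theorem sLift_fac (P : Pretorsion C) (hF : ∀ E, P.TrivialObj E → IsZero (F.obj E)) :
    sσ P ⋙ sLift F hZ P hF = F :=
  CategoryTheory.Functor.ext (fun _ => rfl) (fun A B f => by
    change F.map f = 𝟙 (F.obj A) ≫ F.map f ≫ 𝟙 (F.obj B)
    rw [Category.comp_id, Category.id_comp])

theorem sLift_uniq (P : Pretorsion C) (hF : ∀ E, P.TrivialObj E → IsZero (F.obj E))
    (G : SObj P ⥤ X) (hG : sσ P ⋙ G = F) : G = sLift F hZ P hF := by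
  subst hG
  refine CategoryTheory.Functor.ext (fun _ => rfl) ?_
  rintro ⟨A⟩ ⟨B⟩ f
  obtain ⟨x, rfl⟩ := smk_surj P (A := A) (B := B) f
  change G.map (smk P x) = 𝟙 ((sσ P ⋙ G).obj A) ≫ rawMap (sσ P ⋙ G) hZ x ≫
    𝟙 ((sσ P ⋙ G).obj B)
  rw [Category.comp_id, Category.id_comp]
  cases x with
  | of f => rfl
  | zero =>
    have := zmap_eq (sσ P ⋙ G) hZ hZ (G.map (smk P (Raw.zero : Raw A D)))
      (G.map (smk P (Raw.zero : Raw D B)))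
    exact (G.map_comp (smk P (Raw.zero : Raw A D)) (smk P (Raw.zero : Raw D B))).trans this

end Lift

end Helpers

/-- Theorem 7.1: a pretorsion theory on a category with a strict trivial initial object
admits a universally associated torsion theory. -/
theorem statement18 {C : Type u} [Category.{v} C] [HasInitial C] [HasStrictInitialObjects C]
    (P : Pretorsion C) (h0 : P.TrivialObj (⊥_ C)) :
    ∃ (S : Cat.{max u v, u}) (Q : Pretorsion S) (σ : C ⥤ S),
      IsTorsionTheory Q ∧ IsTorsionFunctor σ P Q ∧
      ∀ (X : Type u') [Category.{v'} X] (R : Pretorsion X), IsTorsionTheory R →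
        ∀ F : C ⥤ X, IsTorsionFunctor F P R →
          (∃! G : S ⥤ X, σ ⋙ G = F) ∧
          (∀ G : S ⥤ X, σ ⋙ G = F → IsTorsionFunctor G Q R) := by
  have hT : ∀ (X : Type u') [Category.{v'} X] (R : Pretorsion X), IsTorsionTheory R →
      ∀ F : C ⥤ X, IsTorsionFunctor F P R → ∀ E, P.TrivialObj E → IsZero (F.obj E) :=
    fun X _ R hR F hF E hE => hR _ ⟨hF.1 _ hE.1, hF.2.1 _ hE.2⟩
  refine ⟨Cat.of (SObj P), sPre P h0, sσ P, fun A hA => s_isZero P hA,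
    ⟨fun A h => h, fun A h => h, fun A => s_exact P h0 A⟩, ?_⟩
  intro X _ R hR F hF
  have hF' := hT X R hR F hF
  refine ⟨⟨sLift F (hF' _ h0) P hF', sLift_fac F (hF' _ h0) P hF', fun G hG =>
    sLift_uniq F (hF' _ h0) P hF' G hG⟩, ?_⟩
  intro G hG
  subst hG
  exact ⟨fun A h => hF.1 A.as h, fun A h => hF.2.1 A.as h, fun A => hF.2.2 A.as⟩

end CoherentPaper
end
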